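/- For every Γ̄ ∈ MCS_χ: Γ̄ is not initial (i.e. Ⓦ⊥ ∉ Γ̄) if and only if there exists Δ̄ ∈ MCS_χ such that Δ̄ R_○ Γ̄. -/

import Mathlib

namespace TJL

/-- Justification terms: constants, variables, !t, t+t, t·t. -/
inductive JTerm : Type
  | const : ℕ → JTerm
  | var : ℕ → JTerm
  | bang : JTerm → JTerm
  | plus : JTerm → JTerm → JTerm
  | app : JTerm → JTerm → JTerm

/-- Formulas of LPLTL^P with `h` agents. -/
inductive Formula (h : ℕ) : Type
  | atom : ℕ → Formula h
  | bot : Formula h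
  | imp : Formula h → Formula h → Formula h
  | next : Formula h → Formula h
  | wprev : Formula h → Formula h
  | funtil : Formula h → Formula h → Formula h
  | fsince : Formula h → Formula h → Formula h
  | jbox : JTerm → Fin h → Formula h → Formula h

namespace Formula

variable {h : ℕ}

def neg (φ : Formula h) : Formula h := φ.imp .bot
def top : Formula h := neg .bot
def sprev (φ : Formula h) : Formula h := neg (wprev (neg φ))
def ev (φ : Formula h) : Formula h := funtil top φ
def always (φ : Formula h) : Formula h := neg (ev (neg φ))
def once (φ : Formula h) : Formula h := fsince top φ
def halways (φ : Formula h) : Formula h := neg (once (neg φ))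
def or' (φ ψ : Formula h) : Formula h := (neg φ).imp ψ
def and' (φ ψ : Formula h) : Formula h := neg (or' (neg φ) (neg ψ))
def iff' (φ ψ : Formula h) : Formula h := and' (φ.imp ψ) (ψ.imp φ)

end Formula

open Formula

/-- A boolean valuation respecting ⊥ and →. -/
def IsPropEval {h : ℕ} (v : Formula h → Bool) : Prop :=
  v .bot = false ∧ ∀ φ ψ : Formula h, v (φ.imp ψ) = (!(v φ) || v ψ)

/-- Propositional tautologies. -/
def Tautology {h : ℕ} (φ : Formula h) : Prop :=
  ∀ v : Formula h → Bool, IsPropEval v → v φ = true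

/-- The axioms of LPLTL^P. -/
inductive Ax {h : ℕ} : Formula h → Prop
  | taut (φ : Formula h) : Tautology φ → Ax φ
  | nextK (φ ψ : Formula h) : Ax ((Formula.next (φ.imp ψ)).imp ((Formula.next φ).imp (Formula.next ψ)))
  | boxK (φ ψ : Formula h) : Ax ((always (φ.imp ψ)).imp ((always φ).imp (always ψ)))
  | func (φ : Formula h) : Ax (iff' (Formula.next (neg φ)) (neg (Formula.next φ)))
  | ind (φ : Formula h) : Ax ((always (φ.imp (Formula.next φ))).imp (φ.imp (always φ)))
  | until1 (φ ψ : Formula h) : Ax ((Formula.funtil φ ψ).imp (ev ψ))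
  | until2 (φ ψ : Formula h) :
      Ax (iff' (Formula.funtil φ ψ) (or' ψ (and' φ (Formula.next (Formula.funtil φ ψ)))))
  | hboxK (φ ψ : Formula h) : Ax ((halways (φ.imp ψ)).imp ((halways φ).imp (halways ψ)))
  | wprevK (φ ψ : Formula h) :
      Ax ((Formula.wprev (φ.imp ψ)).imp ((Formula.wprev φ).imp (Formula.wprev ψ)))
  | sw (φ : Formula h) : Ax ((sprev φ).imp (Formula.wprev φ))
  | fp (φ : Formula h) : Ax (φ.imp (Formula.next (sprev φ)))
  | pf (φ : Formula h) : Ax (φ.imp (Formula.wprev (Formula.next φ)))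
  | initial : Ax (once (Formula.wprev (.bot : Formula h)))
  | hind (φ : Formula h) : Ax ((halways (φ.imp (Formula.wprev φ))).imp (φ.imp (halways φ)))
  | since1 (φ ψ : Formula h) : Ax ((Formula.fsince φ ψ).imp (once ψ))
  | since2 (φ ψ : Formula h) :
      Ax (iff' (Formula.fsince φ ψ) (or' ψ (and' φ (sprev (Formula.fsince φ ψ)))))
  | japp (t s : JTerm) (i : Fin h) (φ ψ : Formula h) :
      Ax ((Formula.jbox t i (φ.imp ψ)).imp ((Formula.jbox s i φ).imp (Formula.jbox (.app t s) i ψ)))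
  | jsum1 (t s : JTerm) (i : Fin h) (φ : Formula h) :
      Ax ((Formula.jbox t i φ).imp (Formula.jbox (.plus t s) i φ))
  | jsum2 (t s : JTerm) (i : Fin h) (φ : Formula h) :
      Ax ((Formula.jbox s i φ).imp (Formula.jbox (.plus t s) i φ))
  | jrefl (t : JTerm) (i : Fin h) (φ : Formula h) : Ax ((Formula.jbox t i φ).imp φ)
  | jpos (t : JTerm) (i : Fin h) (φ : Formula h) :
      Ax ((Formula.jbox t i φ).imp (Formula.jbox (.bang t) i (Formula.jbox t i φ)))

/-- Formulas of the shape [c_n]_{i_n}⋯[c_1]_{i_1}φ with n ≥ 1 and φ an axiom instance. -/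
inductive CSForm {h : ℕ} : Formula h → Prop
  | base (c : ℕ) (i : Fin h) (φ : Formula h) : Ax φ → CSForm (.jbox (.const c) i φ)
  | step (c : ℕ) (i : Fin h) (φ : Formula h) : CSForm φ → CSForm (.jbox (.const c) i φ)

/-- Downward-closed constant specifications. -/
def IsConstSpec {h : ℕ} (CS : Set (Formula h)) : Prop :=
  (∀ φ ∈ CS, CSForm φ) ∧
  (∀ (c : ℕ) (i : Fin h) (φ : Formula h),
    Formula.jbox (.const c) i φ ∈ CS → CSForm φ → φ ∈ CS)

/-- Derivability in LPLTL^P_CS. -/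
inductive Deriv {h : ℕ} (CS : Set (Formula h)) : Formula h → Prop
  | ax {φ : Formula h} : Ax φ → Deriv CS φ
  | cs {φ : Formula h} : φ ∈ CS → Deriv CS φ
  | mp {φ ψ : Formula h} : Deriv CS (φ.imp ψ) → Deriv CS φ → Deriv CS ψ
  | necNext {φ : Formula h} : Deriv CS φ → Deriv CS (.next φ)
  | necWprev {φ : Formula h} : Deriv CS φ → Deriv CS (.wprev φ)
  | necBox {φ : Formula h} : Deriv CS φ → Deriv CS (always φ)
  | necHbox {φ : Formula h} : Deriv CS φ → Deriv CS (halways φ)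

def conjList {h : ℕ} : List (Formula h) → Formula h
  | [] => top
  | φ :: l => and' φ (conjList l)

def disjList {h : ℕ} : List (Formula h) → Formula h
  | [] => .bot
  | φ :: l => or' φ (disjList l)

/-- Γ ⊢_CS φ : derivability from assumptions. -/
def DerivFrom {h : ℕ} (CS : Set (Formula h)) (Γ : Set (Formula h)) (φ : Formula h) : Prop :=
  ∃ L : List (Formula h), (∀ ψ ∈ L, ψ ∈ Γ) ∧ Deriv CS ((conjList L).imp φ)

/-- CS-consistency. -/
def Consistent {h : ℕ} (CS : Set (Formula h)) (Γ : Set (Formula h)) : Prop :=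
  ¬ DerivFrom CS Γ .bot

/-- Maximal CS-consistent sets. -/
def MaxCons {h : ℕ} (CS : Set (Formula h)) (Γ : Set (Formula h)) : Prop :=
  Consistent CS Γ ∧ ∀ Δ, Γ ⊆ Δ → Consistent CS Δ → Δ = Γ

/-- Subformulas. -/
def Subf {h : ℕ} : Formula h → Set (Formula h)
  | .atom P => {.atom P}
  | .bot => {.bot}
  | .imp φ ψ => insert (.imp φ ψ) (Subf φ ∪ Subf ψ)
  | .next φ => insert (.next φ) (Subf φ)
  | .wprev φ => insert (.wprev φ) (Subf φ)
  | .funtil φ ψ => insert (.funtil φ ψ) (Subf φ ∪ Subf ψ)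
  | .fsince φ ψ => insert (.fsince φ ψ) (Subf φ ∪ Subf ψ)
  | .jbox t i φ => insert (.jbox t i φ) (Subf φ)

/-- A_χ := Sub(χ) ∪ Sub(⊤ S Ⓦ⊥). -/
def Achi {h : ℕ} (χ : Formula h) : Set (Formula h) :=
  Subf χ ∪ Subf (Formula.fsince top (Formula.wprev .bot))

/-- Sub⁺(χ) := A_χ ∪ {¬ψ | ψ ∈ A_χ}. -/
def SubPlus {h : ℕ} (χ : Formula h) : Set (Formula h) :=
  Achi χ ∪ (neg '' Achi χ)

/-- MCS_χ : the χ-maximal CS-consistent subsets of Sub⁺(χ). -/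
def ChiMCS {h : ℕ} (CS : Set (Formula h)) (χ : Formula h) : Set (Set (Formula h)) :=
  {Γb | Γb ⊆ SubPlus χ ∧ Consistent CS Γb ∧
    ∀ Δ, Γb ⊆ Δ → Δ ⊆ SubPlus χ → Consistent CS Δ → Δ = Γb}

/-- The relation R_○ on MCS_χ, via representatives Γ, Δ ∈ MCS:
    Γ̄ R_○ Δ̄ iff {○φ | φ ∈ Δ} ⊆ Γ. -/
def RNext {h : ℕ} (CS : Set (Formula h)) (χ : Formula h) (Γb Δb : Set (Formula h)) : Prop :=
  ∃ Γ Δ : Set (Formula h), MaxCons CS Γ ∧ MaxCons CS Δ ∧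
    Γb = Γ ∩ SubPlus χ ∧ Δb = Δ ∩ SubPlus χ ∧
    ∀ φ ∈ Δ, Formula.next φ ∈ Γ

/-- γ is a conjunction of all elements of the finite set S (in some order). -/
def IsConj {h : ℕ} (S : Set (Formula h)) (γ : Formula h) : Prop :=
  ∃ L : List (Formula h), L.Nodup ∧ (∀ ψ, ψ ∈ L ↔ ψ ∈ S) ∧ γ = conjList L

/-- Acceptable sequences of elements of MCS_χ. -/
def Acceptable {h : ℕ} (CS : Set (Formula h)) (χ : Formula h)
    (f : ℕ → Set (Formula h)) : Prop :=
  (∀ n, f n ∈ ChiMCS CS χ) ∧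
  (∀ n, RNext CS χ (f n) (f (n + 1))) ∧
  (∀ n (φ ψ : Formula h), Formula.funtil φ ψ ∈ f n →
    ∃ m, n ≤ m ∧ ψ ∈ f m ∧ ∀ k, n ≤ k → k < m → φ ∈ f k) ∧
  Formula.wprev .bot ∈ f 0

end TJL

namespace TJL

open Formula

variable {h : ℕ} {CS : Set (Formula h)} {Γ Δ : Set (Formula h)} {φ ψ ρ : Formula h}

namespace IsPropEval

variable {v : Formula h → Bool}

theorem neg_eq (hv : IsPropEval v) (φ : Formula h) : v (neg φ) = !v φ := by
  simp [neg, hv.1, hv.2]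

theorem or_eq (hv : IsPropEval v) (φ ψ : Formula h) : v (or' φ ψ) = (v φ || v ψ) := by
  simp [or', hv.2, hv.neg_eq]

theorem and_eq (hv : IsPropEval v) (φ ψ : Formula h) : v (and' φ ψ) = (v φ && v ψ) := by
  simp [and', hv.neg_eq, hv.or_eq]

theorem iff_eq (hv : IsPropEval v) (φ ψ : Formula h) :
    v (iff' φ ψ) = ((!v φ || v ψ) && (!v ψ || v φ)) := by
  simp [iff', hv.and_eq, hv.2]

theorem imp_iff (hv : IsPropEval v) (φ ψ : Formula h) :
    v (φ.imp ψ) = true ↔ (v φ = true → v ψ = true) := by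
  rw [hv.2]; cases v φ <;> simp

theorem conjList_iff (hv : IsPropEval v) (L : List (Formula h)) :
    v (conjList L) = true ↔ ∀ ψ ∈ L, v ψ = true := by
  induction L with
  | nil => simp [conjList, top, hv.neg_eq, hv.1]
  | cons a L ih => simp [conjList, hv.and_eq, ih]

end IsPropEval

theorem Deriv.of_eval (H : ∀ v : Formula h → Bool, IsPropEval v → v φ = true) : Deriv CS φ :=
  .ax (.taut φ H)

theorem Deriv.of_eval₁ (hφ : Deriv CS φ)
    (H : ∀ v : Formula h → Bool, IsPropEval v → v φ = true → v ψ = true) : Deriv CS ψ :=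
  .mp (.of_eval fun v hv => (hv.imp_iff _ _).2 (H v hv)) hφ

theorem Deriv.of_eval₂ (hφ : Deriv CS φ) (hψ : Deriv CS ψ)
    (H : ∀ v : Formula h → Bool, IsPropEval v → v φ = true → v ψ = true → v ρ = true) :
    Deriv CS ρ :=
  .mp (.of_eval₁ (ψ := ψ.imp ρ) hφ fun v hv hφ => (hv.imp_iff _ _).2 (H v hv hφ)) hψ

theorem Deriv.imp_trans (h₁ : Deriv CS (φ.imp ψ)) (h₂ : Deriv CS (ψ.imp ρ)) :
    Deriv CS (φ.imp ρ) :=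
  .of_eval₂ h₁ h₂ fun v hv => by simp only [hv.imp_iff]; tauto

theorem Deriv.next_mono (H : Deriv CS (φ.imp ψ)) : Deriv CS (φ.next.imp ψ.next) :=
  .mp (.ax (.nextK φ ψ)) (.necNext H)

theorem Deriv.wprev_mono (H : Deriv CS (φ.imp ψ)) : Deriv CS (φ.wprev.imp ψ.wprev) :=
  .mp (.ax (.wprevK φ ψ)) (.necWprev H)

/-- No successor state is initial: `○Ⓦ⊥` is refutable. -/
theorem deriv_not_next_wprev_bot : Deriv CS (neg (Formula.next (.wprev .bot))) := by
  have h₁ : Deriv CS (Formula.wprev (.bot : Formula h) |>.imp (.wprev (neg top))) :=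
    .wprev_mono (.of_eval fun v hv => by simp [hv.imp_iff, hv.1])
  have h₂ : Deriv CS (Formula.imp (sprev top) (neg (.wprev (.bot : Formula h)))) :=
    .of_eval₁ h₁ fun v hv => by
      simp only [hv.imp_iff, sprev, hv.neg_eq]; grind
  have h₃ : Deriv CS (Formula.next (neg (.wprev (.bot : Formula h)))) :=
    .mp (.next_mono h₂) (.mp (.ax (.fp top)) (.of_eval fun v hv => by simp [top, hv.neg_eq, hv.1]))
  refine .of_eval₂ h₃ (.ax (.func (.wprev .bot))) fun v hv => ?_
  rw [hv.iff_eq]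
  intro a b
  simpa [a] using b

/-- If `○φ` is refutable, then `φ` can only hold at the initial state. -/
theorem Deriv.imp_wprev_bot (H : Deriv CS (φ.next.imp .bot)) : Deriv CS (φ.imp (.wprev .bot)) :=
  .imp_trans (.ax (.pf φ)) (.wprev_mono H)

theorem deriv_next_conjList (M : List (Formula h)) :
    Deriv CS ((conjList M).next.imp (conjList (M.map .next))) := by
  induction M with
  | nil => exact .of_eval fun v hv => by simp [conjList, hv.imp_iff, top, hv.neg_eq, hv.1]
  | cons a M ih =>
    have h₁ : Deriv CS ((conjList (a :: M)).next.imp a.next) :=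
      .next_mono (.of_eval fun v hv => by simp [conjList, hv.imp_iff, hv.and_eq]; tauto)
    have h₂ : Deriv CS ((conjList (a :: M)).next.imp (conjList M).next) :=
      .next_mono (.of_eval fun v hv => by simp [conjList, hv.imp_iff, hv.and_eq])
    refine .of_eval₂ h₁ (.imp_trans h₂ ih) fun v hv => ?_
    simp only [hv.imp_iff, List.map_cons]
    simp only [conjList, hv.and_eq]
    grind

theorem DerivFrom.of_mem (H : φ ∈ Γ) : DerivFrom CS Γ φ :=
  ⟨[φ], by simpa using H, .of_eval fun v hv => by simp [hv.imp_iff, hv.conjList_iff]⟩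

theorem DerivFrom.of_deriv (H : Deriv CS φ) : DerivFrom CS Γ φ :=
  ⟨[], by simp, .of_eval₁ H fun v hv => by simp [hv.imp_iff]; tauto⟩

theorem DerivFrom.mp (h₁ : DerivFrom CS Γ (φ.imp ψ)) (h₂ : DerivFrom CS Γ φ) :
    DerivFrom CS Γ ψ := by
  obtain ⟨L, hL, dL⟩ := h₁
  obtain ⟨M, hM, dM⟩ := h₂
  refine ⟨L ++ M, ?_, .of_eval₂ dL dM fun v hv => ?_⟩
  · intro ψ hψ
    exact (List.mem_append.1 hψ).elim (hL ψ) (hM ψ)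
  · simp only [hv.imp_iff, hv.conjList_iff, List.mem_append]
    grind

theorem DerivFrom.mono (hΓ : Γ ⊆ Δ) (H : DerivFrom CS Γ φ) : DerivFrom CS Δ φ := by
  obtain ⟨L, hL, dL⟩ := H
  exact ⟨L, fun ψ hψ => hΓ (hL ψ hψ), dL⟩

theorem Consistent.mono (hΓ : Γ ⊆ Δ) (H : Consistent CS Δ) : Consistent CS Γ :=
  fun d => H (d.mono hΓ)

theorem DerivFrom.deduction (H : DerivFrom CS (insert φ Γ) ψ) : DerivFrom CS Γ (φ.imp ψ) := by
  classical
  obtain ⟨L, hL, dL⟩ := H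
  refine ⟨L.filter (· ≠ φ), ?_, .of_eval₁ dL fun v hv => ?_⟩
  · intro ρ hρ
    obtain ⟨h₁, h₂⟩ := List.mem_filter.1 hρ
    exact (hL ρ h₁).resolve_left (by simpa using h₂)
  · simp only [hv.imp_iff, hv.conjList_iff, List.mem_filter, decide_eq_true_eq]
    intro a b c
    refine a fun ρ hρ => ?_
    by_cases e : ρ = φ
    · rwa [e]
    · exact b ρ ⟨hρ, e⟩

theorem MaxCons.mem_of_derivFrom (hΓ : MaxCons CS Γ) (H : DerivFrom CS Γ φ) : φ ∈ Γ := by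
  rw [← hΓ.2 (insert φ Γ) (Set.subset_insert _ _) fun d => hΓ.1 (d.deduction.mp H)]
  exact Set.mem_insert _ _

theorem MaxCons.mem_or_neg_mem (hΓ : MaxCons CS Γ) (φ : Formula h) : φ ∈ Γ ∨ neg φ ∈ Γ := by
  by_cases H : Consistent CS (insert φ Γ)
  · left
    rw [← hΓ.2 _ (Set.subset_insert _ _) H]
    exact Set.mem_insert _ _
  · exact .inr (hΓ.mem_of_derivFrom (not_not.1 H).deduction)

/-- Lindenbaum's lemma. -/
theorem Consistent.exists_maxCons (H : Consistent CS Γ) : ∃ Δ, Γ ⊆ Δ ∧ MaxCons CS Δ := by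
  obtain ⟨Δ, hΔ, hmax⟩ := zorn_subset_nonempty {Δ | Consistent CS Δ} (fun c hc hch hne =>
    ⟨⋃₀ c, fun ⟨L, hL, dL⟩ => by
      obtain ⟨t, htc, ht⟩ := DirectedOn.exists_mem_subset_of_finite_of_subset_sUnion hne
        hch.directedOn L.finite_toSet (s := {ψ | ψ ∈ L}) hL
      exact hc htc ⟨L, ht, dL⟩, fun s hs => Set.subset_sUnion_of_mem hs⟩) Γ H
  exact ⟨Δ, hΔ, hmax.prop, fun Θ h₁ h₂ => (hmax.eq_of_subset h₂ h₁).symm⟩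

theorem MaxCons.inter_subPlus_mem_chiMCS (hΓ : MaxCons CS Γ) (χ : Formula h) :
    Γ ∩ SubPlus χ ∈ ChiMCS CS χ := by
  refine ⟨Set.inter_subset_right, hΓ.1.mono Set.inter_subset_left, fun Δ hΔ hsub hcons => ?_⟩
  refine Set.Subset.antisymm (fun ψ hψ => ⟨?_, hsub hψ⟩) hΔ
  rcases hsub hψ with hA | ⟨ρ, hA, rfl⟩
  · refine (hΓ.mem_or_neg_mem ψ).resolve_right fun hn => hcons ?_
    have : neg ψ ∈ Δ := hΔ ⟨hn, .inr ⟨ψ, hA, rfl⟩⟩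
    exact (DerivFrom.of_mem this).mp (.of_mem hψ)
  · refine (hΓ.mem_or_neg_mem ρ).resolve_left fun hp => hcons ?_
    exact (DerivFrom.of_mem hψ).mp (.of_mem (hΔ ⟨hp, .inl hA⟩))

theorem exists_maxCons_inter_subPlus_eq {χ : Formula h} (H : Γ ∈ ChiMCS CS χ) :
    ∃ Δ, MaxCons CS Δ ∧ Γ = Δ ∩ SubPlus χ := by
  obtain ⟨hsub, hcons, hmax⟩ := H
  obtain ⟨Δ, hΔ, hΔmax⟩ := hcons.exists_maxCons
  exact ⟨Δ, hΔmax, (hmax _ (Set.subset_inter hΔ hsub) Set.inter_subset_right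
    (hΔmax.1.mono Set.inter_subset_left)).symm⟩

theorem wprev_bot_mem_subPlus (χ : Formula h) : Formula.wprev .bot ∈ SubPlus χ :=
  .inl (.inr (by simp [Subf]))

theorem MaxCons.consistent_image_next (hΓ : MaxCons CS Γ) (H : Formula.wprev .bot ∉ Γ) :
    Consistent CS (Formula.next '' Γ) := by
  rintro ⟨L, hL, dL⟩
  obtain ⟨M, hM, rfl⟩ : ∃ M : List (Formula h), (∀ ψ ∈ M, ψ ∈ Γ) ∧ M.map .next = L := by
    clear dL
    induction L with
    | nil => exact ⟨[], by simp⟩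
    | cons a L ih =>
      obtain ⟨M, hM, rfl⟩ := ih fun ψ hψ => hL ψ (List.mem_cons_of_mem _ hψ)
      obtain ⟨b, hb, rfl⟩ := hL a List.mem_cons_self
      exact ⟨b :: M, by simpa using ⟨hb, hM⟩, rfl⟩
  exact H (hΓ.mem_of_derivFrom ⟨M, hM, ((deriv_next_conjList M).imp_trans dL).imp_wprev_bot⟩)

end TJL

open TJL TJL.Formula in
/-- Γ̄ ∈ MCS_χ is not initial (Ⓦ⊥ ∉ Γ̄) iff there exists Δ̄ ∈ MCS_χ with Δ̄ R_○ Γ̄. -/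
theorem not_initial_iff_has_predecessor (h : ℕ) (hh : 1 ≤ h)
    (CS : Set (Formula h)) (hCS : IsConstSpec CS) (χ : Formula h) :
    ∀ Γb ∈ ChiMCS CS χ,
      (Formula.wprev .bot ∉ Γb ↔ ∃ Δb ∈ ChiMCS CS χ, RNext CS χ Δb Γb) := by
  intro Γb hΓb
  constructor
  · intro H
    obtain ⟨Γ, hΓ, rfl⟩ := exists_maxCons_inter_subPlus_eq hΓb
    have hw : Formula.wprev .bot ∉ Γ := fun hw => H ⟨hw, wprev_bot_mem_subPlus χ⟩
    obtain ⟨Δ, hsub, hΔ⟩ := (hΓ.consistent_image_next hw).exists_maxCons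
    exact ⟨Δ ∩ SubPlus χ, hΔ.inter_subPlus_mem_chiMCS χ, Δ, Γ, hΔ, hΓ, rfl, rfl,
      fun φ hφ => hsub ⟨φ, hφ, rfl⟩⟩
  · rintro ⟨_, -, Δ, Γ, hΔ, -, rfl, rfl, hR⟩ hw
    exact hΔ.1 (DerivFrom.mp (.of_deriv deriv_not_next_wprev_bot) (.of_mem (hR _ hw.1)))
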